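/- The real vector space Sol = {f ∈ ℝ[x₁,x₂,x₃] : e₂(∂)f = e₆(∂)f = e₄(∂)²f = 0} has dimension 96, while H = {f ∈ ℝ[x₁,x₂,x₃] : e₂(∂)f = e₄(∂)f = e₆(∂)f = 0} has dimension 48; in particular H is a proper subspace of Sol. -/

import Mathlib

open MvPolynomial

noncomputable def dop (φ : MvPolynomial (Fin 3) ℝ) :
    MvPolynomial (Fin 3) ℝ →ₗ[ℝ] MvPolynomial (Fin 3) ℝ :=
  φ.support.sum fun s => φ.coeff s •
    (((pderiv (0 : Fin 3)).toLinearMap ^ s 0) *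
     ((pderiv (1 : Fin 3)).toLinearMap ^ s 1) *
     ((pderiv (2 : Fin 3)).toLinearMap ^ s 2))

noncomputable def e2 : MvPolynomial (Fin 3) ℝ := X 0 ^ 2 + X 1 ^ 2 + X 2 ^ 2
noncomputable def e4 : MvPolynomial (Fin 3) ℝ :=
  X 1 ^ 2 * X 2 ^ 2 + X 2 ^ 2 * X 0 ^ 2 + X 0 ^ 2 * X 1 ^ 2
noncomputable def e6 : MvPolynomial (Fin 3) ℝ := X 0 ^ 2 * X 1 ^ 2 * X 2 ^ 2

/-- The solution space of the system `e₂(∂)f = e₆(∂)f = e₄(∂)²f = 0`, as a subspace. -/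
noncomputable def Sol : Submodule ℝ (MvPolynomial (Fin 3) ℝ) :=
  LinearMap.ker (dop e2) ⊓ LinearMap.ker (dop e6) ⊓ LinearMap.ker (dop e4 ∘ₗ dop e4)

/-- The space of `W(B₃)`-harmonic polynomials, as a subspace. -/
noncomputable def H : Submodule ℝ (MvPolynomial (Fin 3) ℝ) :=
  LinearMap.ker (dop e2) ⊓ LinearMap.ker (dop e4) ⊓ LinearMap.ker (dop e6)

section JointKernel

variable {R V : Type*} [CommRing R] [AddCommGroup V] [Module ℝ V] (D : R →+* Module.End ℝ V)

/-- The common kernel of the operators `D f`, for `f` in the list `l`. -/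
def jointKer (l : List R) : Submodule ℝ V := ⨅ f ∈ l, LinearMap.ker (D f)

/-- The operator `D f` is surjective on the common kernel of the operators attached to `l`. -/
def SurjOnJointKer (l : List R) (f : R) : Prop :=
  ∀ u ∈ jointKer D l, ∃ v ∈ jointKer D l, D f v = u

variable {D}

theorem mem_jointKer {l : List R} {v : V} : v ∈ jointKer D l ↔ ∀ f ∈ l, D f v = 0 := by
  simp [jointKer]

theorem mem_jointKer_cons {l : List R} {f : R} {v : V} :
    v ∈ jointKer D (f :: l) ↔ D f v = 0 ∧ v ∈ jointKer D l := by
  simp [mem_jointKer]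

theorem jointKer_nil : jointKer D [] = ⊤ := by
  simp [jointKer]

theorem map_mul_apply (f g : R) (v : V) : D (f * g) v = D f (D g v) := by
  simp

theorem map_apply_comm (f g : R) (v : V) : D f (D g v) = D g (D f v) := by
  rw [← map_mul_apply, mul_comm, map_mul_apply]

theorem apply_mem_jointKer {l : List R} {v : V} (g : R) (hv : v ∈ jointKer D l) :
    D g v ∈ jointKer D l := by
  rw [mem_jointKer] at hv ⊢
  intro f hf
  rw [map_apply_comm, hv f hf, map_zero]

theorem jointKer_perm {l l' : List R} (h : l.Perm l') : jointKer D l = jointKer D l' := by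
  ext v
  simp only [mem_jointKer, h.mem_iff]

theorem SurjOnJointKer.perm {l l' : List R} {f : R} (hf : SurjOnJointKer D l f)
    (h : l.Perm l') : SurjOnJointKer D l' f := by
  rwa [SurjOnJointKer, ← jointKer_perm h]

theorem apply_eq_of_sub_mem {l : List R} {f g : R} {v : V} (hv : v ∈ jointKer D l)
    (h : f - g ∈ Ideal.ofList l) : D f v = D g v := by
  have key : ∀ r ∈ Ideal.ofList l, D r v = 0 := by
    intro r hr
    induction hr using Submodule.span_induction with
    | mem r hr => exact mem_jointKer.1 hv r hr
    | zero => simp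
    | add r s _ _ hr hs => simp [hr, hs]
    | smul a r _ hr => rw [smul_eq_mul, map_mul_apply, hr, map_zero]
  rw [← sub_eq_zero, ← LinearMap.sub_apply, ← map_sub, key _ h]

theorem jointKer_cons_congr {l : List R} {f g : R} (h : f - g ∈ Ideal.ofList l) :
    jointKer D (f :: l) = jointKer D (g :: l) := by
  ext v
  simp only [mem_jointKer_cons]
  exact and_congr_left fun hv => by rw [apply_eq_of_sub_mem hv h]

theorem SurjOnJointKer.congr {l : List R} {f g : R} (hg : SurjOnJointKer D l g)
    (h : f - g ∈ Ideal.ofList l) : SurjOnJointKer D l f := by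
  intro u hu
  obtain ⟨v, hv, rfl⟩ := hg u hu
  exact ⟨v, hv, apply_eq_of_sub_mem hv h⟩

theorem SurjOnJointKer.mul {l : List R} {f g : R} (hf : SurjOnJointKer D l f)
    (hg : SurjOnJointKer D l g) : SurjOnJointKer D l (f * g) := by
  intro u hu
  obtain ⟨v, hv, rfl⟩ := hf u hu
  obtain ⟨w, hw, rfl⟩ := hg v hv
  exact ⟨w, hw, map_mul_apply f g w⟩

theorem SurjOnJointKer.swap {l : List R} {f g : R} (hg : SurjOnJointKer D l g)
    (hf : SurjOnJointKer D (g :: l) f) : SurjOnJointKer D (f :: l) g := by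
  intro u hu
  obtain ⟨hfu, hu⟩ := mem_jointKer_cons.1 hu
  obtain ⟨v, hv, rfl⟩ := hg u hu
  obtain ⟨w, hw, hwv⟩ := hf (D f v)
    (mem_jointKer_cons.2 ⟨by rw [map_apply_comm, hfu], apply_mem_jointKer f hv⟩)
  obtain ⟨hgw, hw⟩ := mem_jointKer_cons.1 hw
  exact ⟨v - w, mem_jointKer_cons.2 ⟨by simp [hwv], sub_mem hv hw⟩, by simp [hgw]⟩

theorem SurjOnJointKer.cons_mul {l : List R} {f g h : R} (hg : SurjOnJointKer D l g)
    (hfg : SurjOnJointKer D (g :: l) f) (hfh : SurjOnJointKer D (h :: l) f) :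
    SurjOnJointKer D (g * h :: l) f := by
  intro u hu
  obtain ⟨hghu, hu⟩ := mem_jointKer_cons.1 hu
  rw [mul_comm, map_mul_apply] at hghu
  obtain ⟨w, hw, hwu⟩ := hfh (D g u) (mem_jointKer_cons.2 ⟨hghu, apply_mem_jointKer g hu⟩)
  obtain ⟨hhw, hw⟩ := mem_jointKer_cons.1 hw
  obtain ⟨w', hw', rfl⟩ := hg w hw
  obtain ⟨w'', hw'', hwu''⟩ := hfg (u - D f w') (mem_jointKer_cons.2
    ⟨by rw [map_sub, ← hwu, map_apply_comm, sub_self], sub_mem hu (apply_mem_jointKer f hw')⟩)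
  obtain ⟨hgw'', hw''⟩ := mem_jointKer_cons.1 hw''
  refine ⟨w' + w'', mem_jointKer_cons.2 ⟨?_, add_mem hw' hw''⟩, by simp [hwu'']⟩
  rw [mul_comm, map_mul_apply, map_add, hgw'', add_zero, hhw]

theorem SurjOnJointKer.of_locallyNilpotent {l : List R} {f g : R} (hg : SurjOnJointKer D l g)
    (hf : SurjOnJointKer D (g :: l) f) (hnil : ∀ v, ∃ n : ℕ, D (g ^ n) v = 0) :
    SurjOnJointKer D l f := by
  have hpow : ∀ n : ℕ, SurjOnJointKer D (g ^ n :: l) f := by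
    intro n
    induction n with
    | zero =>
      intro u hu
      have : u = 0 := by simpa using (mem_jointKer_cons.1 hu).1
      exact ⟨0, zero_mem _, by simp [this]⟩
    | succ n ih => rw [pow_succ']; exact hg.cons_mul hf ih
  intro u hu
  obtain ⟨n, hn⟩ := hnil u
  obtain ⟨v, hv, hvu⟩ := hpow n u (mem_jointKer_cons.2 ⟨hn, hu⟩)
  exact ⟨v, (mem_jointKer_cons.1 hv).2, hvu⟩

theorem SurjOnJointKer.rank_cons_mul {l : List R} {g h : R} (hg : SurjOnJointKer D l g) :
    Module.rank ℝ (jointKer D (g * h :: l)) =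
      Module.rank ℝ (jointKer D (g :: l)) + Module.rank ℝ (jointKer D (h :: l)) := by
  have hle : jointKer D (g :: l) ≤ jointKer D (g * h :: l) := by
    intro v hv
    obtain ⟨hgv, hv⟩ := mem_jointKer_cons.1 hv
    exact mem_jointKer_cons.2 ⟨by rw [mul_comm, map_mul_apply, hgv, map_zero], hv⟩
  have hmaps : ∀ v ∈ jointKer D (g * h :: l), D g v ∈ jointKer D (h :: l) := by
    intro v hv
    obtain ⟨hgv, hv⟩ := mem_jointKer_cons.1 hv
    exact mem_jointKer_cons.2 ⟨by rw [← map_mul_apply, mul_comm, hgv], apply_mem_jointKer g hv⟩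
  have hsurj : Function.Surjective ((D g).restrict hmaps) := by
    rintro ⟨u, hu⟩
    obtain ⟨hhu, hu⟩ := mem_jointKer_cons.1 hu
    obtain ⟨v, hv, rfl⟩ := hg u hu
    exact ⟨⟨v, mem_jointKer_cons.2 ⟨by rw [mul_comm, map_mul_apply, hhu], hv⟩⟩, rfl⟩
  have hker : LinearMap.ker ((D g).restrict hmaps) =
      (jointKer D (g :: l)).submoduleOf (jointKer D (g * h :: l)) := by
    ext ⟨v, hv⟩
    simp [LinearMap.restrict_apply, Submodule.submoduleOf, mem_jointKer_cons,
      (mem_jointKer_cons.1 hv).2]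
  rw [LinearMap.rank_eq_of_surjective hsurj, hker,
    (Submodule.submoduleOfEquivOfLe hle).rank_eq, add_comm]

theorem add_mem_ofList_pair (a b p q : R) : p * a + q * b ∈ Ideal.ofList [a, b] :=
  add_mem (Ideal.mul_mem_left _ _ (Ideal.subset_span (by simp)))
    (Ideal.mul_mem_left _ _ (Ideal.subset_span (by simp)))

section Triple

variable {a b c p q : R}

theorem SurjOnJointKer.sumSq_of_mem (hp : p = a ^ 2 + b ^ 2 + c ^ 2)
    (hbc : SurjOnJointKer D [b, a] c) : SurjOnJointKer D [b, a] p :=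
  (hbc.mul hbc).congr (by
    convert! add_mem_ofList_pair b a b a using 1
    rw [hp]; ring)

theorem SurjOnJointKer.sumSq (hp : p = a ^ 2 + b ^ 2 + c ^ 2) (hab : SurjOnJointKer D [a] b)
    (hbc : SurjOnJointKer D [b, a] c) (hnil : ∀ v, ∃ n : ℕ, D (b ^ n) v = 0) :
    SurjOnJointKer D [a] p :=
  hab.of_locallyNilpotent (hbc.sumSq_of_mem hp) hnil

theorem sub_mem_ofList_sumSq (hq : q = b ^ 2 * c ^ 2 + c ^ 2 * a ^ 2 + a ^ 2 * b ^ 2) :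
    q - b * (b * (c * c)) ∈ Ideal.ofList [p, a] := by
  convert! add_mem_ofList_pair p a 0 (c ^ 2 * a + a * b ^ 2) using 1
  rw [hq]; ring

theorem SurjOnJointKer.sumSqMul (hp : p = a ^ 2 + b ^ 2 + c ^ 2)
    (hq : q = b ^ 2 * c ^ 2 + c ^ 2 * a ^ 2 + a ^ 2 * b ^ 2)
    (hab : SurjOnJointKer D [a] b) (hac : SurjOnJointKer D [a] c)
    (hbc : SurjOnJointKer D [b, a] c) (hcb : SurjOnJointKer D [c, a] b) :
    SurjOnJointKer D [p, a] q := by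
  have hb : SurjOnJointKer D [p, a] b := hab.swap (hbc.sumSq_of_mem hp)
  have hc : SurjOnJointKer D [p, a] c := hac.swap (hcb.sumSq_of_mem (hp.trans (by ring)))
  exact (hb.mul (hb.mul (hc.mul hc))).congr (sub_mem_ofList_sumSq hq)

theorem rank_jointKer_of_sumSq (hp : p = a ^ 2 + b ^ 2 + c ^ 2) (hbc : SurjOnJointKer D [b, a] c)
    (hrank : Module.rank ℝ (jointKer D [c, b, a]) = 1) :
    Module.rank ℝ (jointKer D [b, p, a]) = 2 := by
  have hsub : p - c * c ∈ Ideal.ofList [b, a] := by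
    convert! add_mem_ofList_pair b a b a using 1
    rw [hp]; ring
  rw [jointKer_perm (List.Perm.swap p b [a]), jointKer_cons_congr hsub, hbc.rank_cons_mul, hrank,
    one_add_one_eq_two]

theorem rank_jointKer_of_sumSq_of_sumSqMul (hp : p = a ^ 2 + b ^ 2 + c ^ 2)
    (hq : q = b ^ 2 * c ^ 2 + c ^ 2 * a ^ 2 + a ^ 2 * b ^ 2)
    (hab : SurjOnJointKer D [a] b) (hac : SurjOnJointKer D [a] c)
    (hbc : SurjOnJointKer D [b, a] c) (hcb : SurjOnJointKer D [c, a] b)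
    (hrank : Module.rank ℝ (jointKer D [c, b, a]) = 1) :
    Module.rank ℝ (jointKer D [q, p, a]) = 8 := by
  have hb : SurjOnJointKer D [p, a] b := hab.swap (hbc.sumSq_of_mem hp)
  have hc : SurjOnJointKer D [p, a] c := hac.swap (hcb.sumSq_of_mem (hp.trans (by ring)))
  rw [jointKer_cons_congr (sub_mem_ofList_sumSq hq), hb.rank_cons_mul, hb.rank_cons_mul,
    hc.rank_cons_mul, rank_jointKer_of_sumSq hp hbc hrank,
    rank_jointKer_of_sumSq (hp.trans (by ring)) hcb
      (by rwa [jointKer_perm (List.Perm.swap b c [a])] at hrank)]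
  norm_num

end Triple

section Coordinates

variable {x : Fin 3 → R} {p q : R} {i j k : Fin 3}

theorem surjOnJointKer_coordinate (hp : p = x i ^ 2 + x j ^ 2 + x k ^ 2)
    (hS : ∀ (l : List (Fin 3)) (i : Fin 3), i ∉ l → SurjOnJointKer D (l.map x) (x i))
    (hnil : ∀ i v, ∃ n : ℕ, D (x i ^ n) v = 0) (hij : i ≠ j) (hik : i ≠ k) (hjk : j ≠ k) :
    SurjOnJointKer D [p] (x i) :=
  (hS [] i (by simp)).swap (SurjOnJointKer.sumSq hp (hS [i] j (by simp [hij.symm]))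
    (hS [j, i] k (by simp [hik.symm, hjk.symm])) (hnil j))

theorem surjOnJointKer_cons_coordinate (hp : p = x i ^ 2 + x j ^ 2 + x k ^ 2)
    (hq : q = x j ^ 2 * x k ^ 2 + x k ^ 2 * x i ^ 2 + x i ^ 2 * x j ^ 2)
    (hS : ∀ (l : List (Fin 3)) (i : Fin 3), i ∉ l → SurjOnJointKer D (l.map x) (x i))
    (hij : i ≠ j) (hik : i ≠ k) (hjk : j ≠ k) :
    SurjOnJointKer D [x i, p] q :=
  (SurjOnJointKer.sumSqMul hp hq (hS [i] j (by simp [hij.symm])) (hS [i] k (by simp [hik.symm]))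
    (hS [j, i] k (by simp [hik.symm, hjk.symm]))
    (hS [k, i] j (by simp [hij.symm, hjk]))).perm (List.Perm.swap (x i) p [])

theorem rank_jointKer_coordinate (hp : p = x i ^ 2 + x j ^ 2 + x k ^ 2)
    (hq : q = x j ^ 2 * x k ^ 2 + x k ^ 2 * x i ^ 2 + x i ^ 2 * x j ^ 2)
    (hS : ∀ (l : List (Fin 3)) (i : Fin 3), i ∉ l → SurjOnJointKer D (l.map x) (x i))
    (hrank : Module.rank ℝ (jointKer D [x 0, x 1, x 2]) = 1)
    (hij : i ≠ j) (hik : i ≠ k) (hjk : j ≠ k) :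
    Module.rank ℝ (jointKer D [x i, q, p]) = 8 := by
  have hperm : [x i, q, p].Perm [q, p, x i] := List.perm_append_comm (l₁ := [x i])
  have hperm' : [x k, x j, x i].Perm [x 0, x 1, x 2] := by
    have : [k, j, i].Perm [0, 1, 2] := by
      clear hp hq hperm
      revert i j k
      decide
    simpa using this.map x
  rw [jointKer_perm hperm]
  refine rank_jointKer_of_sumSq_of_sumSqMul hp hq (hS [i] j (by simp [hij.symm]))
    (hS [i] k (by simp [hik.symm])) (hS [j, i] k (by simp [hik.symm, hjk.symm]))
    (hS [k, i] j (by simp [hij.symm, hjk])) ?_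
  rw [jointKer_perm hperm', hrank]

theorem surjOnJointKer_prodSq
    (hp : p = x 0 ^ 2 + x 1 ^ 2 + x 2 ^ 2)
    (hq : q = x 1 ^ 2 * x 2 ^ 2 + x 2 ^ 2 * x 0 ^ 2 + x 0 ^ 2 * x 1 ^ 2)
    (hS : ∀ (l : List (Fin 3)) (i : Fin 3), i ∉ l → SurjOnJointKer D (l.map x) (x i))
    (hnil : ∀ i v, ∃ n : ℕ, D (x i ^ n) v = 0) :
    SurjOnJointKer D [x 0 * (x 0 * (x 1 * (x 1 * (x 2 * x 2)))), p] q := by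
  have h0 : SurjOnJointKer D [p] (x 0) :=
    surjOnJointKer_coordinate hp hS hnil (by decide) (by decide) (by decide)
  have h1 : SurjOnJointKer D [p] (x 1) :=
    surjOnJointKer_coordinate (j := 2) (k := 0) (hp.trans (by ring)) hS hnil
      (by decide) (by decide) (by decide)
  have h2 : SurjOnJointKer D [p] (x 2) :=
    surjOnJointKer_coordinate (j := 0) (k := 1) (hp.trans (by ring)) hS hnil
      (by decide) (by decide) (by decide)
  have h0' : SurjOnJointKer D [x 0, p] q :=
    surjOnJointKer_cons_coordinate hp hq hS (by decide) (by decide) (by decide)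
  have h1' : SurjOnJointKer D [x 1, p] q :=
    surjOnJointKer_cons_coordinate (j := 2) (k := 0) (hp.trans (by ring)) (hq.trans (by ring)) hS
      (by decide) (by decide) (by decide)
  have h2' : SurjOnJointKer D [x 2, p] q :=
    surjOnJointKer_cons_coordinate (j := 0) (k := 1) (hp.trans (by ring)) (hq.trans (by ring)) hS
      (by decide) (by decide) (by decide)
  exact h0.cons_mul h0' (h0.cons_mul h0' (h1.cons_mul h1' (h1.cons_mul h1' (h2.cons_mul h2' h2'))))

theorem rank_jointKer_prodSq
    (hp : p = x 0 ^ 2 + x 1 ^ 2 + x 2 ^ 2)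
    (hq : q = x 1 ^ 2 * x 2 ^ 2 + x 2 ^ 2 * x 0 ^ 2 + x 0 ^ 2 * x 1 ^ 2)
    (hS : ∀ (l : List (Fin 3)) (i : Fin 3), i ∉ l → SurjOnJointKer D (l.map x) (x i))
    (hnil : ∀ i v, ∃ n : ℕ, D (x i ^ n) v = 0)
    (hrank : Module.rank ℝ (jointKer D [x 0, x 1, x 2]) = 1) :
    Module.rank ℝ (jointKer D [x 0 * (x 0 * (x 1 * (x 1 * (x 2 * x 2)))), q, p]) = 48 := by
  have h0 : SurjOnJointKer D [q, p] (x 0) :=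
    (surjOnJointKer_coordinate hp hS hnil (by decide) (by decide) (by decide)).swap
      (surjOnJointKer_cons_coordinate hp hq hS (by decide) (by decide) (by decide))
  have h1 : SurjOnJointKer D [q, p] (x 1) :=
    (surjOnJointKer_coordinate (j := 2) (k := 0) (hp.trans (by ring)) hS hnil
      (by decide) (by decide) (by decide)).swap
      (surjOnJointKer_cons_coordinate (j := 2) (k := 0) (hp.trans (by ring)) (hq.trans (by ring))
        hS (by decide) (by decide) (by decide))
  have h2 : SurjOnJointKer D [q, p] (x 2) :=
    (surjOnJointKer_coordinate (j := 0) (k := 1) (hp.trans (by ring)) hS hnil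
      (by decide) (by decide) (by decide)).swap
      (surjOnJointKer_cons_coordinate (j := 0) (k := 1) (hp.trans (by ring)) (hq.trans (by ring))
        hS (by decide) (by decide) (by decide))
  rw [h0.rank_cons_mul, h0.rank_cons_mul, h1.rank_cons_mul, h1.rank_cons_mul, h2.rank_cons_mul,
    rank_jointKer_coordinate (i := 0) (j := 1) (k := 2) hp hq hS hrank
      (by decide) (by decide) (by decide),
    rank_jointKer_coordinate (i := 1) (j := 2) (k := 0) (hp.trans (by ring)) (hq.trans (by ring))
      hS hrank (by decide) (by decide) (by decide),
    rank_jointKer_coordinate (i := 2) (j := 0) (k := 1) (hp.trans (by ring)) (hq.trans (by ring))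
      hS hrank (by decide) (by decide) (by decide)]
  norm_num

end Coordinates

end JointKernel

section Dop

theorem commute_pderiv (i j : Fin 3) :
    Commute ((pderiv i).toLinearMap : Module.End ℝ (MvPolynomial (Fin 3) ℝ))
      (pderiv j).toLinearMap := by
  refine LinearMap.ext fun p => ?_
  have h : ⁅pderiv (R := ℝ) i, pderiv (R := ℝ) j⁆ = 0 := by
    refine derivation_ext fun k => ?_
    rw [Derivation.commutator_apply]
    simp [pderiv_X, Pi.single_apply, apply_ite]
  have := congrArg (fun d : Derivation ℝ (MvPolynomial (Fin 3) ℝ) (MvPolynomial (Fin 3) ℝ) => d p) h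
  rw [Derivation.commutator_apply] at this
  exact sub_eq_zero.1 this

/-- The monomial differential operator `∂ ^ s`. -/
noncomputable def pderivMonomial :
    Multiplicative (Fin 3 →₀ ℕ) →* Module.End ℝ (MvPolynomial (Fin 3) ℝ) where
  toFun s := (pderiv (0 : Fin 3)).toLinearMap ^ s.toAdd 0 *
    (pderiv (1 : Fin 3)).toLinearMap ^ s.toAdd 1 * (pderiv (2 : Fin 3)).toLinearMap ^ s.toAdd 2
  map_one' := by simp
  map_mul' s t := by
    have h01 := (commute_pderiv 1 0).pow_pow (s.toAdd 1) (t.toAdd 0)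
    have h02 := (commute_pderiv 2 0).pow_pow (s.toAdd 2) (t.toAdd 0)
    have h12 := (commute_pderiv 2 1).pow_pow (s.toAdd 2) (t.toAdd 1)
    simp only [toAdd_mul, Finsupp.add_apply, pow_add]
    rw [(h02.mul_right h12).mul_mul_mul_comm, h01.mul_mul_mul_comm]

/-- The ring homomorphism sending `φ` to the operator `φ(∂)`. -/
noncomputable def dopHom :
    MvPolynomial (Fin 3) ℝ →+* Module.End ℝ (MvPolynomial (Fin 3) ℝ) :=
  (AddMonoidAlgebra.lift ℝ _ _ pderivMonomial).toRingHom

theorem dopHom_apply (φ : MvPolynomial (Fin 3) ℝ) : dopHom φ = dop φ :=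
  AddMonoidAlgebra.lift_apply pderivMonomial φ

theorem dopHom_X (i : Fin 3) : dopHom (X i) = (pderiv i).toLinearMap := by
  have : dopHom (X i) = (1 : ℝ) • pderivMonomial (.ofAdd (Finsupp.single i 1)) :=
    AddMonoidAlgebra.lift_single pderivMonomial _ _
  rw [this]
  fin_cases i <;> simp [pderivMonomial]

/-- Antidifferentiation in the `i`-th variable. -/
noncomputable def antideriv (i : Fin 3) : Module.End ℝ (MvPolynomial (Fin 3) ℝ) :=
  (basisMonomials (Fin 3) ℝ).constr ℝ fun s =>
    monomial (s + Finsupp.single i 1) ((s i + 1 : ℝ)⁻¹)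

theorem antideriv_monomial (i : Fin 3) (s : Fin 3 →₀ ℕ) :
    antideriv i (monomial s 1) = monomial (s + Finsupp.single i 1) ((s i + 1 : ℝ)⁻¹) := by
  simpa only [antideriv, coe_basisMonomials] using (basisMonomials (Fin 3) ℝ).constr_basis ℝ
    (fun s => monomial (s + Finsupp.single i 1) ((s i + 1 : ℝ)⁻¹)) s

theorem pderiv_antideriv (i : Fin 3) (p : MvPolynomial (Fin 3) ℝ) :
    pderiv i (antideriv i p) = p := by
  suffices h : (pderiv i).toLinearMap ∘ₗ antideriv i = LinearMap.id from LinearMap.congr_fun h p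
  refine (basisMonomials (Fin 3) ℝ).ext fun s => ?_
  have : (s i + 1 : ℝ) ≠ 0 := by positivity
  simp [antideriv_monomial, pderiv_monomial, this]

theorem pderiv_antideriv_comm {i j : Fin 3} (h : j ≠ i) (p : MvPolynomial (Fin 3) ℝ) :
    pderiv j (antideriv i p) = antideriv i (pderiv j p) := by
  suffices h : (pderiv j).toLinearMap ∘ₗ antideriv i = antideriv i ∘ₗ (pderiv j).toLinearMap from
    LinearMap.congr_fun h p
  refine (basisMonomials (Fin 3) ℝ).ext fun s => ?_
  have hm : monomial (s - Finsupp.single j 1) (s j : ℝ) =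
      (s j : ℝ) • monomial (s - Finsupp.single j 1) (1 : ℝ) := by simp [smul_monomial]
  simp only [coe_basisMonomials, LinearMap.comp_apply, Derivation.coeFn_coe, antideriv_monomial,
    pderiv_monomial, one_mul]
  rw [hm, map_smul, antideriv_monomial, smul_monomial]
  rcases Nat.eq_zero_or_pos (s j) with h0 | h0
  · simp [h0, h.symm]
  · have hs : s + Finsupp.single i 1 - Finsupp.single j 1 =
        s - Finsupp.single j 1 + Finsupp.single i 1 := by
      ext k
      simp only [Finsupp.tsub_apply, Finsupp.add_apply, Finsupp.single_apply]
      split_ifs <;> simp_all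
    rw [hs]
    simp [h.symm, h, mul_comm]

theorem surjOnJointKer_X (l : List (Fin 3)) (i : Fin 3) (hi : i ∉ l) :
    SurjOnJointKer dopHom (l.map X) (X i) := by
  intro u hu
  refine ⟨antideriv i u, mem_jointKer.2 fun f hf => ?_, ?_⟩
  · obtain ⟨j, hj, rfl⟩ := List.mem_map.1 hf
    have := mem_jointKer.1 hu (X j) hf
    simp only [dopHom_X, Derivation.coeFn_coe] at this ⊢
    rw [pderiv_antideriv_comm (ne_of_mem_of_not_mem hj hi), this, map_zero]
  · simp [dopHom_X, pderiv_antideriv]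

theorem iterate_pderiv_eq_zero (i : Fin 3) (v : MvPolynomial (Fin 3) ℝ) :
    ∃ n : ℕ, ((pderiv i).toLinearMap ^ n) v = 0 := by
  have hmon : ∀ (n : ℕ) (s : Fin 3 →₀ ℕ) (c : ℝ), s i < n →
      ((pderiv i).toLinearMap ^ n) (monomial s c) = 0 := by
    intro n
    induction n with
    | zero => simp
    | succ n ih =>
      intro s c hs
      rw [pow_succ, Module.End.mul_apply, Derivation.coeFn_coe, pderiv_monomial]
      rcases Nat.eq_zero_or_pos (s i) with h0 | h0
      · simp [h0]
      · exact ih _ _ (by simp; omega)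
  induction v using MvPolynomial.induction_on' with
  | monomial s c => exact ⟨s i + 1, hmon _ s c (Nat.lt_succ_self _)⟩
  | add p q hp hq =>
    obtain ⟨m, hm⟩ := hp
    obtain ⟨n, hn⟩ := hq
    refine ⟨m + n, ?_⟩
    rw [map_add, pow_add, Module.End.mul_apply, Module.End.mul_apply, hn, map_zero, add_zero,
      ← Module.End.mul_apply, ← pow_add, add_comm, pow_add, Module.End.mul_apply, hm, map_zero]

theorem exists_dopHom_X_pow_eq_zero (i : Fin 3) (v : MvPolynomial (Fin 3) ℝ) :
    ∃ n : ℕ, dopHom (X i ^ n) v = 0 := by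
  simpa [dopHom_X] using iterate_pderiv_eq_zero i v

theorem rank_jointKer_X :
    Module.rank ℝ (jointKer dopHom
      [(X 0 : MvPolynomial (Fin 3) ℝ), X 1, X 2]) = 1 := by
  have h : jointKer dopHom
      [(X 0 : MvPolynomial (Fin 3) ℝ), X 1, X 2] = ℝ ∙ (1 : MvPolynomial (Fin 3) ℝ) := by
    refine le_antisymm (fun f hf => ?_) ?_
    · have hf' : ∀ i, pderiv i f = 0 := by
        intro i
        have := mem_jointKer.1 hf (X i) (by fin_cases i <;> simp)
        simpa [dopHom_X] using this
      refine Submodule.mem_span_singleton.2 ⟨coeff 0 f, ?_⟩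
      ext s
      by_cases hs : s = 0
      · simp [hs]
      · obtain ⟨i, hi⟩ := Finsupp.ne_iff.1 hs
        have hle : Finsupp.single i 1 ≤ s := by
          simpa [Nat.one_le_iff_ne_zero] using hi
        have := coeff_pderiv f (i := i) (s - Finsupp.single i 1)
        rw [hf', tsub_add_cancel_of_le hle, coeff_zero, eq_comm, mul_eq_zero] at this
        have hne : (((s - Finsupp.single i 1 : Fin 3 →₀ ℕ) i : ℝ) + 1) ≠ 0 := by positivity
        rw [this.resolve_right hne]
        simp [coeff_one, Ne.symm hs]
    · rw [Submodule.span_singleton_le_iff_mem, mem_jointKer]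
      simp [dopHom_X]
  rw [h, rank_span_set (LinearIndepOn.singleton one_ne_zero), Cardinal.mk_singleton]

theorem H_eq_jointKer : H = jointKer dopHom [e6, e4, e2] := by
  ext f
  simp only [H, mem_jointKer_cons, jointKer_nil, Submodule.mem_top, Submodule.mem_inf,
    LinearMap.mem_ker, dopHom_apply, and_true]
  exact ⟨fun ⟨⟨h2, h4⟩, h6⟩ => ⟨h6, h4, h2⟩, fun ⟨h6, h4, h2⟩ => ⟨⟨h2, h4⟩, h6⟩⟩

theorem Sol_eq_jointKer : Sol = jointKer dopHom [e4 * e4, e6, e2] := by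
  ext f
  simp only [Sol, mem_jointKer_cons, jointKer_nil, Submodule.mem_top, Submodule.mem_inf,
    LinearMap.mem_ker, map_mul_apply, LinearMap.comp_apply, ← dopHom_apply, and_true]
  exact ⟨fun ⟨⟨h2, h6⟩, h4⟩ => ⟨h4, h6, h2⟩, fun ⟨h4, h6, h2⟩ => ⟨⟨h2, h6⟩, h4⟩⟩

theorem H_le_Sol : H ≤ Sol := by
  rintro f ⟨⟨h2, h4⟩, h6⟩
  refine ⟨⟨h2, h6⟩, LinearMap.mem_ker.2 ?_⟩
  rw [LinearMap.comp_apply, LinearMap.mem_ker.1 h4, map_zero]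

theorem e6_eq : e6 = X 0 * (X 0 * (X 1 * (X 1 * (X 2 * X 2)))) := by
  rw [e6]
  ring

theorem rank_H : Module.rank ℝ H = 48 := by
  have h := rank_jointKer_prodSq (x := X) (p := e2) (q := e4) e2.eq_def e4.eq_def
    surjOnJointKer_X exists_dopHom_X_pow_eq_zero rank_jointKer_X
  rw [← e6_eq] at h
  rw [H_eq_jointKer, h]

theorem rank_Sol : Module.rank ℝ Sol = 96 := by
  have hsurj := surjOnJointKer_prodSq (x := X) (p := e2) (q := e4) e2.eq_def e4.eq_def
    surjOnJointKer_X exists_dopHom_X_pow_eq_zero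
  rw [← e6_eq] at hsurj
  rw [Sol_eq_jointKer, hsurj.rank_cons_mul, jointKer_perm (List.Perm.swap e6 e4 [e2]),
    ← H_eq_jointKer, rank_H]
  norm_num

end Dop

theorem dim_Sol_and_H :
    Module.rank ℝ Sol = 96 ∧ Module.rank ℝ H = 48 ∧ H < Sol := by
  refine ⟨rank_Sol, rank_H, lt_of_le_of_ne H_le_Sol fun h => ?_⟩
  have h48 := rank_H
  rw [h, rank_Sol] at h48
  norm_num at h48
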